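/- arXiv:1006.2794 — 2 statements merged into one kernel-verified Lean document; each statement's English description precedes it below -/
import Mathlib

section
/- Let ξ be a d×d density matrix, η ∈ ℝ, c = cos η, s = sin η, and E[ρ] = c²ρ + s²ξ + i c s (ξρ − ρξ). Then E[ξ] = ξ, any two density matrices satisfy ‖ρ − ξ‖ ≤ √2 in Hilbert–Schmidt norm, and for every d×d density matrix ρ and every n ≥ 0 one has ‖E^n[ρ] − ξ‖ ≤ √2 · |c|^n. In particular, if |c| < 1 the iterates E^n[ρ] converge to ξ. -/
open Matrix Complex BigOperators Filter
open scoped ComplexOrder Topology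

noncomputable section

/-- The Hilbert–Schmidt (Frobenius) norm `‖X‖ = √(tr(X†X))`. -/
def hsNorm {n : Type*} [Fintype n] (X : Matrix n n ℂ) : ℝ :=
  Real.sqrt (Matrix.trace (Xᴴ * X)).re

/-- The homogenization channel `E[ρ] = c²ρ + s²ξ + ics(ξρ − ρξ)`, `c = cos η`,
`s = sin η`. -/
def homogChan {d : ℕ} (ξ : Matrix (Fin d) (Fin d) ℂ) (η : ℝ)
    (ρ : Matrix (Fin d) (Fin d) ℂ) : Matrix (Fin d) (Fin d) ℂ :=
  ((Real.cos η : ℂ) ^ 2) • ρ + ((Real.sin η : ℂ) ^ 2) • ξ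
    + (Complex.I * (Real.cos η : ℂ) * (Real.sin η : ℂ)) • (ξ * ρ - ρ * ξ)

/-- A density matrix `ξ` satisfies `ξ² ≤ ξ`. -/
lemma dens_sub_sq {d : ℕ} (ξ : Matrix (Fin d) (Fin d) ℂ)
    (hξ : ξ.PosSemidef) (hξt : ξ.trace = 1) : (ξ - ξ * ξ).PosSemidef := by
  have hs := hξ.1.spectral_theorem
  have hsum := hξ.1.trace_eq_sum_eigenvalues
  rw [hξt] at hsum
  have hsum' : ∑ i, hξ.1.eigenvalues i = 1 := by
    have := congrArg Complex.re hsum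
    simpa using this.symm
  have h0 := hξ.eigenvalues_nonneg
  have h1 : ∀ i, hξ.1.eigenvalues i ≤ 1 := fun i => by
    rw [← hsum']
    exact Finset.single_le_sum (f := hξ.1.eigenvalues) (fun j _ => h0 j) (Finset.mem_univ i)
  set U : Matrix (Fin d) (Fin d) ℂ := (hξ.1.eigenvectorUnitary : Matrix (Fin d) (Fin d) ℂ) with hU
  have hUU : Uᴴ * U = 1 := by
    have := Unitary.coe_star_mul_self hξ.1.eigenvectorUnitary
    simpa [star_eq_conjTranspose] using this
  set D : Matrix (Fin d) (Fin d) ℂ := diagonal (RCLike.ofReal ∘ hξ.1.eigenvalues) with hD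
  have hs' : ξ = U * D * Uᴴ := by
    rw [Unitary.conjStarAlgAut_apply] at hs
    simpa [star_eq_conjTranspose] using hs
  have e : ξ - ξ * ξ = U * (D - D * D) * Uᴴ := by
    have : ξ * ξ = U * (D * D) * Uᴴ := by
      calc ξ * ξ = (U * D * Uᴴ) * (U * D * Uᴴ) := by rw [← hs']
        _ = U * D * (Uᴴ * U) * D * Uᴴ := by simp only [Matrix.mul_assoc]
        _ = _ := by rw [hUU]; simp only [Matrix.mul_assoc, Matrix.mul_one]
    rw [this, Matrix.mul_sub, Matrix.sub_mul, ← hs']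
  rw [e]
  apply Matrix.PosSemidef.mul_mul_conjTranspose_same
  rw [hD, diagonal_mul_diagonal, diagonal_sub]
  apply Matrix.PosSemidef.diagonal
  intro i
  have : (0:ℝ) ≤ hξ.1.eigenvalues i - hξ.1.eigenvalues i * hξ.1.eigenvalues i := by
    nlinarith [h0 i, h1 i]
  have h2 : (0:ℂ) ≤ ((hξ.1.eigenvalues i - hξ.1.eigenvalues i * hξ.1.eigenvalues i : ℝ) : ℂ) := by
    exact_mod_cast this
  simpa using h2

lemma psd_trace_re {d : ℕ} {A : Matrix (Fin d) (Fin d) ℂ} (h : A.PosSemidef) :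
    0 ≤ A.trace.re := (Complex.le_def.1 h.trace_nonneg).1

lemma comm_step {d : ℕ} (ξ δ : Matrix (Fin d) (Fin d) ℂ)
    (hξ : ξ.PosSemidef) (hξt : ξ.trace = 1) (hδ : δᴴ = δ) :
    2 * (ξ * (ξ * (δ * δ))).trace.re - 2 * (ξ * (δ * (ξ * δ))).trace.re ≤ (δ * δ).trace.re := by
  have h1 := psd_trace_re ((dens_sub_sq ξ hξ hξt).mul_mul_conjTranspose_same δ)
  have h2 := psd_trace_re (posSemidef_conjTranspose_mul_self (ξ * δ + δ * ξ - δ))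
  have e1 : (δ * (ξ - ξ * ξ) * δᴴ).trace = (ξ * (δ * δ)).trace - (ξ * (ξ * (δ * δ))).trace := by
    rw [hδ, Matrix.mul_assoc, trace_mul_comm, Matrix.mul_assoc, Matrix.sub_mul, trace_sub,
      Matrix.mul_assoc]
  have hξh : ξᴴ = ξ := hξ.1
  have e2 : ((ξ * δ + δ * ξ - δ)ᴴ * (ξ * δ + δ * ξ - δ)).trace
      = 2 * (ξ * (δ * (ξ * δ))).trace + 2 * (ξ * (ξ * (δ * δ))).trace
        - 4 * (ξ * (δ * δ)).trace + (δ * δ).trace := by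
    have a1 : (δ * (ξ * (ξ * δ))).trace = (ξ * (ξ * (δ * δ))).trace := by
      rw [trace_mul_comm]; simp only [Matrix.mul_assoc]
    have a2 : (δ * (ξ * (δ * ξ))).trace = (ξ * (δ * (ξ * δ))).trace := by
      rw [trace_mul_comm]
      simp only [Matrix.mul_assoc]
    have a3 : (ξ * (δ * (δ * ξ))).trace = (ξ * (ξ * (δ * δ))).trace := by
      rw [trace_mul_comm ξ (ξ * (δ * δ))]; simp only [Matrix.mul_assoc]
    have a4 : (δ * (ξ * δ)).trace = (ξ * (δ * δ)).trace := by
      rw [trace_mul_comm]; simp only [Matrix.mul_assoc]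
    have a5 : (δ * (δ * ξ)).trace = (ξ * (δ * δ)).trace := by
      rw [trace_mul_comm ξ]; simp only [Matrix.mul_assoc]
    simp only [conjTranspose_sub, conjTranspose_add, conjTranspose_mul, hδ, hξh, Matrix.add_mul,
      Matrix.mul_add, Matrix.sub_mul, Matrix.mul_sub, trace_add, trace_sub, Matrix.mul_assoc,
      a1, a2, a3, a4, a5]
    ring
  rw [e1] at h1
  rw [e2] at h2
  simp at h1 h2
  linarith

lemma chan_herm {d : ℕ} (ξ δ : Matrix (Fin d) (Fin d) ℂ) (hξh : ξᴴ = ξ) (hδ : δᴴ = δ) (c s : ℝ) :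
    (((c : ℂ) ^ 2) • δ + (Complex.I * c * s) • (ξ * δ - δ * ξ))ᴴ
      = ((c : ℂ) ^ 2) • δ + (Complex.I * c * s) • (ξ * δ - δ * ξ) := by
  simp only [conjTranspose_add, conjTranspose_smul, conjTranspose_sub, conjTranspose_mul, hξh, hδ]
  rw [← neg_sub (ξ * δ) (δ * ξ), smul_neg, ← neg_smul]
  simp

lemma chan_step {d : ℕ} (ξ δ : Matrix (Fin d) (Fin d) ℂ)
    (hξ : ξ.PosSemidef) (hξt : ξ.trace = 1) (hδ : δᴴ = δ) (c s : ℝ) (hcs : c ^ 2 + s ^ 2 = 1) :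
    hsNorm (((c : ℂ) ^ 2) • δ + (Complex.I * c * s) • (ξ * δ - δ * ξ)) ≤ |c| * hsNorm δ := by
  have hξh : ξᴴ = ξ := hξ.1
  have hM := chan_herm ξ δ hξh hδ c s
  have key := comm_step ξ δ hξ hξt hδ
  unfold hsNorm
  rw [← Real.sqrt_sq_eq_abs, ← Real.sqrt_mul (sq_nonneg c)]
  apply Real.sqrt_le_sqrt
  rw [hM, hδ]
  have e : ((((c : ℂ) ^ 2) • δ + (Complex.I * c * s) • (ξ * δ - δ * ξ)) *
      (((c : ℂ) ^ 2) • δ + (Complex.I * c * s) • (ξ * δ - δ * ξ))).trace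
      = ((c ^ 4 : ℝ) : ℂ) * (δ * δ).trace + ((c ^ 2 * s ^ 2 : ℝ) : ℂ) *
        (2 * (ξ * (ξ * (δ * δ))).trace - 2 * (ξ * (δ * (ξ * δ))).trace) := by
    have a1 : (δ * (ξ * (ξ * δ))).trace = (ξ * (ξ * (δ * δ))).trace := by
      rw [trace_mul_comm]; simp only [Matrix.mul_assoc]
    have a2 : (δ * (ξ * (δ * ξ))).trace = (ξ * (δ * (ξ * δ))).trace := by
      rw [trace_mul_comm]; simp only [Matrix.mul_assoc]
    have a3 : (ξ * (δ * (δ * ξ))).trace = (ξ * (ξ * (δ * δ))).trace := by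
      rw [trace_mul_comm ξ (ξ * (δ * δ))]; simp only [Matrix.mul_assoc]
    have a4 : (δ * (ξ * δ)).trace = (ξ * (δ * δ)).trace := by
      rw [trace_mul_comm]; simp only [Matrix.mul_assoc]
    have a5 : (δ * (δ * ξ)).trace = (ξ * (δ * δ)).trace := by
      rw [trace_mul_comm ξ]; simp only [Matrix.mul_assoc]
    simp only [Matrix.add_mul, Matrix.mul_add, Matrix.sub_mul, Matrix.mul_sub, Matrix.smul_mul,
      Matrix.mul_smul, trace_add, trace_sub, trace_smul, smul_eq_mul, Matrix.mul_assoc,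
      a1, a2, a3, a4, a5]
    push_cast
    linear_combination (c ^ 2 * s ^ 2 *
      (2 * (ξ * (δ * (ξ * δ))).trace - 2 * (ξ * (ξ * (δ * δ))).trace)) * Complex.I_sq
  rw [e, Complex.add_re, Complex.re_ofReal_mul, Complex.re_ofReal_mul]
  have : (2 * (ξ * (ξ * (δ * δ))).trace - 2 * (ξ * (δ * (ξ * δ))).trace).re
      = 2 * (ξ * (ξ * (δ * δ))).trace.re - 2 * (ξ * (δ * (ξ * δ))).trace.re := by simp
  rw [this]
  have h3 := mul_le_mul_of_nonneg_left key (by positivity : 0 ≤ c ^ 2 * s ^ 2)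
  have h4 : c ^ 2 * (δ * δ).trace.re
      = c ^ 4 * (δ * δ).trace.re + c ^ 2 * s ^ 2 * (δ * δ).trace.re := by
    linear_combination (-(c ^ 2 * (δ * δ).trace.re)) * hcs
  linarith

open scoped MatrixOrder Matrix.Norms.L2Operator in
lemma dens_dist {d : ℕ} (ξ ρ : Matrix (Fin d) (Fin d) ℂ)
    (hξ : ξ.PosSemidef) (hξt : ξ.trace = 1) (hρ : ρ.PosSemidef) (hρt : ρ.trace = 1) :
    hsNorm (ρ - ξ) ≤ Real.sqrt 2 := by
  apply Real.sqrt_le_sqrt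
  have h1 := psd_trace_re (dens_sub_sq ξ hξ hξt)
  have h2 := psd_trace_re (dens_sub_sq ρ hρ hρt)
  have h3 : 0 ≤ (ρ * ξ).trace.re := by
    obtain ⟨B, hB⟩ := CStarAlgebra.nonneg_iff_eq_star_mul_self.1 hρ.nonneg
    rw [star_eq_conjTranspose] at hB
    have := psd_trace_re (hξ.mul_mul_conjTranspose_same B)
    rwa [trace_mul_comm, ← Matrix.mul_assoc, ← hB] at this
  have a : ξᴴ = ξ := hξ.1
  have b : ρᴴ = ρ := hρ.1
  rw [trace_sub, hξt] at h1
  rw [trace_sub, hρt] at h2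
  simp only [conjTranspose_sub, a, b, Matrix.sub_mul, Matrix.mul_sub, trace_sub,
    trace_mul_comm ξ ρ]
  simp at h1 h2 ⊢
  linarith

lemma entry_le_hsNorm {d : ℕ} (X : Matrix (Fin d) (Fin d) ℂ) (i j : Fin d) :
    ‖X i j‖ ≤ hsNorm X := by
  apply Real.le_sqrt_of_sq_le
  have : (Xᴴ * X).trace.re = ∑ j, ∑ i, ‖X i j‖ ^ 2 := by
    simp only [Matrix.trace, Matrix.diag, Matrix.mul_apply, conjTranspose_apply, Complex.re_sum]
    refine Finset.sum_congr rfl fun j _ => Finset.sum_congr rfl fun i _ => ?_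
    rw [Complex.sq_norm, Complex.normSq_apply]
    simp
  rw [this]
  calc ‖X i j‖ ^ 2 ≤ ∑ i, ‖X i j‖ ^ 2 :=
        Finset.single_le_sum (f := fun i => ‖X i j‖ ^ 2) (fun _ _ => by positivity)
          (Finset.mem_univ i)
    _ ≤ _ := Finset.single_le_sum (f := fun j => ∑ i, ‖X i j‖ ^ 2)
          (fun _ _ => by positivity) (Finset.mem_univ j)

lemma chan_sub {d : ℕ} (ξ ρ : Matrix (Fin d) (Fin d) ℂ) (η : ℝ) :
    homogChan ξ η ρ - ξ = ((Real.cos η : ℂ) ^ 2) • (ρ - ξ)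
      + (Complex.I * (Real.cos η : ℂ) * (Real.sin η : ℂ)) •
        (ξ * (ρ - ξ) - (ρ - ξ) * ξ) := by
  have h : ((Real.sin η : ℂ) ^ 2) = 1 - ((Real.cos η : ℂ) ^ 2) := by
    have := Real.sin_sq_add_cos_sq η
    have h2 : ((Real.sin η : ℂ) ^ 2) + ((Real.cos η : ℂ) ^ 2) = 1 := by exact_mod_cast this
    linear_combination h2
  have h5 : ξ * (ρ - ξ) - (ρ - ξ) * ξ = ξ * ρ - ρ * ξ := by
    rw [Matrix.mul_sub, Matrix.sub_mul]; abel
  rw [h5, homogChan, h, sub_smul, one_smul, smul_sub _ ρ ξ]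
  abel

lemma iter_bound {d : ℕ} (ξ ρ : Matrix (Fin d) (Fin d) ℂ)
    (hξ : ξ.PosSemidef) (hξt : ξ.trace = 1) (hρ : ρ.PosSemidef) (hρt : ρ.trace = 1)
    (η : ℝ) (n : ℕ) :
    ((homogChan ξ η)^[n] ρ - ξ)ᴴ = (homogChan ξ η)^[n] ρ - ξ ∧
    hsNorm ((homogChan ξ η)^[n] ρ - ξ) ≤ Real.sqrt 2 * |Real.cos η| ^ n := by
  induction n with
  | zero =>
    refine ⟨?_, ?_⟩
    · exact hρ.1.sub hξ.1
    · simpa using dens_dist ξ ρ hξ hξt hρ hρt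
  | succ n ih =>
    rw [Function.iterate_succ_apply', chan_sub]
    refine ⟨chan_herm ξ _ hξ.1 ih.1 _ _, ?_⟩
    refine (chan_step ξ _ hξ hξt ih.1 _ _ (Real.cos_sq_add_sin_sq η)).trans ?_
    refine (mul_le_mul_of_nonneg_left ih.2 (abs_nonneg _)).trans (le_of_eq ?_)
    ring

/-- `E[ξ] = ξ`; any two density matrices are within Hilbert–Schmidt distance `√2`;
`‖E^n[ρ] − ξ‖ ≤ √2 |c|^n`; and if `|c| < 1` the iterates `E^n[ρ]` converge to `ξ`. -/
theorem stmt5 {d : ℕ} (ξ : Matrix (Fin d) (Fin d) ℂ)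
    (hξ : ξ.PosSemidef) (hξt : ξ.trace = 1) (η : ℝ) :
    homogChan ξ η ξ = ξ ∧
    (∀ ρ : Matrix (Fin d) (Fin d) ℂ, ρ.PosSemidef → ρ.trace = 1 →
      hsNorm (ρ - ξ) ≤ Real.sqrt 2) ∧
    (∀ ρ : Matrix (Fin d) (Fin d) ℂ, ρ.PosSemidef → ρ.trace = 1 → ∀ n : ℕ,
      hsNorm ((homogChan ξ η)^[n] ρ - ξ) ≤ Real.sqrt 2 * |Real.cos η| ^ n) ∧
    (|Real.cos η| < 1 → ∀ ρ : Matrix (Fin d) (Fin d) ℂ, ρ.PosSemidef → ρ.trace = 1 →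
      Tendsto (fun n : ℕ => (homogChan ξ η)^[n] ρ) atTop (𝓝 ξ)) := by
  refine ⟨?_, fun ρ hρ hρt => dens_dist ξ ρ hξ hξt hρ hρt,
    fun ρ hρ hρt n => (iter_bound ξ ρ hξ hξt hρ hρt η n).2, fun hc ρ hρ hρt => ?_⟩
  · have := chan_sub ξ ξ η
    rw [← sub_eq_zero, this]
    simp
  · refine tendsto_pi_nhds.2 ?_
    intro i
    refine tendsto_pi_nhds.2 ?_
    intro j
    rw [tendsto_iff_norm_sub_tendsto_zero]
    have hlim : Tendsto (fun n : ℕ => Real.sqrt 2 * |Real.cos η| ^ n) atTop (𝓝 0) := by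
      simpa using (tendsto_pow_atTop_nhds_zero_of_lt_one (abs_nonneg _) hc).const_mul (Real.sqrt 2)
    refine squeeze_zero (fun _ => norm_nonneg _) (fun n => ?_) hlim
    exact (entry_le_hsNorm ((homogChan ξ η)^[n] ρ - ξ) i j).trans
      (iter_bound ξ ρ hξ hξt hρ hρt η n).2
end
end

section
/- Let Ω be a density matrix on ℂ^d⊗ℂ^d, η ∈ ℝ, and U_η = cos η · I + i sin η · S the partial swap. Let Ω' = U_η Ω U_η†, and let ρ₁, ρ₂ (resp. ρ'₁, ρ'₂) denote the partial traces of Ω (resp. Ω') over the second and first factor. Then ρ'₁ + ρ'₂ = ρ₁ + ρ₂; i.e., a partial swap collision preserves the average single-particle state. -/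
open Matrix Complex BigOperators
open scoped ComplexOrder

noncomputable section

/-- The swap operator `S` on `ℂ^d ⊗ ℂ^d`, determined by `S(x ⊗ y) = y ⊗ x`. -/
def swapOp (d : ℕ) : Matrix (Fin d × Fin d) (Fin d × Fin d) ℂ :=
  Matrix.of fun p q => if p.1 = q.2 ∧ p.2 = q.1 then 1 else 0

/-- The partial swap `U_η = cos η · I + i sin η · S`. -/
def pswap (d : ℕ) (η : ℝ) : Matrix (Fin d × Fin d) (Fin d × Fin d) ℂ :=
  (Real.cos η : ℂ) • 1 + (Complex.I * (Real.sin η : ℂ)) • swapOp d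

/-- Partial trace over the second tensor factor. -/
def ptr2 {a b : Type*} [Fintype a] [Fintype b]
    (M : Matrix (a × b) (a × b) ℂ) : Matrix a a ℂ :=
  Matrix.of fun i j => ∑ k, M (i, k) (j, k)

/-- Partial trace over the first tensor factor. -/
def ptr1 {a b : Type*} [Fintype a] [Fintype b]
    (M : Matrix (a × b) (a × b) ℂ) : Matrix b b ℂ :=
  Matrix.of fun i j => ∑ k, M (k, i) (k, j)

theorem swapOp_mul_apply {d : ℕ} (M : Matrix (Fin d × Fin d) (Fin d × Fin d) ℂ)
    (p q : Fin d × Fin d) : (swapOp d * M) p q = M p.swap q := by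
  rw [Matrix.mul_apply, Finset.sum_eq_single p.swap]
  · simp [swapOp]
  · rintro ⟨b1, b2⟩ _ hb
    have : ¬ (p.1 = b2 ∧ p.2 = b1) := by
      rintro ⟨h1, h2⟩
      exact hb (by rw [← h1, ← h2]; rfl)
    simp [swapOp, this]
  · simp

theorem mul_swapOp_apply {d : ℕ} (M : Matrix (Fin d × Fin d) (Fin d × Fin d) ℂ)
    (p q : Fin d × Fin d) : (M * swapOp d) p q = M p q.swap := by
  rw [Matrix.mul_apply, Finset.sum_eq_single q.swap]
  · simp [swapOp]
  · rintro ⟨b1, b2⟩ _ hb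
    have : ¬ (b1 = q.2 ∧ b2 = q.1) := by
      rintro ⟨h1, h2⟩
      exact hb (by rw [h1, h2]; rfl)
    simp [swapOp, this]
  · simp

theorem swapOp_conjTranspose (d : ℕ) : (swapOp d)ᴴ = swapOp d := by
  ext p q
  simp only [swapOp, Matrix.conjTranspose_apply, Matrix.of_apply]
  by_cases h : p.1 = q.2 ∧ p.2 = q.1
  · simp [h.1, h.2]
  · have h' : ¬ (q.1 = p.2 ∧ q.2 = p.1) := fun k => h ⟨k.2.symm, k.1.symm⟩
    simp [h, h']

theorem pswap_conj_apply {d : ℕ} (M : Matrix (Fin d × Fin d) (Fin d × Fin d) ℂ) (η : ℝ)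
    (p q : Fin d × Fin d) : (pswap d η * M * (pswap d η)ᴴ) p q =
      (Real.cos η : ℂ) ^ 2 * M p q + (Real.sin η : ℂ) ^ 2 * M p.swap q.swap
      + Complex.I * Real.sin η * Real.cos η * (M p.swap q - M p q.swap) := by
  have h : (pswap d η)ᴴ =
      (Real.cos η : ℂ) • 1 + (-(Complex.I * (Real.sin η : ℂ))) • swapOp d := by
    simp only [pswap, Matrix.conjTranspose_add, Matrix.conjTranspose_smul,
      Matrix.conjTranspose_one, swapOp_conjTranspose, star_mul', RCLike.star_def,
      Complex.conj_ofReal, Complex.conj_I, neg_mul]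
  rw [h]
  simp only [pswap, Matrix.add_mul, Matrix.mul_add, Matrix.smul_mul, Matrix.mul_smul,
    Matrix.one_mul, Matrix.mul_one, Matrix.add_apply, Matrix.smul_apply, smul_eq_mul,
    swapOp_mul_apply, mul_swapOp_apply]
  linear_combination (-(Real.sin η : ℂ) ^ 2 * M p.swap q.swap) * Complex.I_sq

/-- A partial swap collision preserves the average single-particle state:
if `Ω' = U_η Ω U_η†` then `ρ'₁ + ρ'₂ = ρ₁ + ρ₂`. -/
theorem stmt7 {d : ℕ} (Ω : Matrix (Fin d × Fin d) (Fin d × Fin d) ℂ)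
    (hΩ : Ω.PosSemidef) (hΩt : Ω.trace = 1) (η : ℝ) :
    ptr2 (pswap d η * Ω * (pswap d η)ᴴ) + ptr1 (pswap d η * Ω * (pswap d η)ᴴ)
      = ptr2 Ω + ptr1 Ω := by
  ext i j
  have hcs : (Real.cos η : ℂ) ^ 2 + (Real.sin η : ℂ) ^ 2 = 1 := by
    exact_mod_cast Real.cos_sq_add_sin_sq η
  simp only [ptr1, ptr2, Matrix.add_apply, Matrix.of_apply, pswap_conj_apply,
    Prod.swap_prod_mk, Finset.sum_add_distrib, ← Finset.mul_sum, Finset.sum_sub_distrib]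
  linear_combination (∑ k, Ω (i, k) (j, k) + ∑ k, Ω (k, i) (k, j)) * hcs
end
end
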